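/- The number of rooted binary trees with n nodes, canonically embedded in Z (root at abscissa 0, left child at abscissa i-1 and right child at abscissa i+1 of a node at abscissa i), having exactly n_i nodes at abscissa i for ℓ ≤ i ≤ r (with all n_i positive, ℓ ≤ 0 ≤ r, and n = Σ n_i), equals (n_0/(n_ℓ n_r)) · C(n_{-1}+n_1, n_0 - 1) · ∏_{ℓ ≤ i ≤ r, i ≠ 0} C(n_{i-1}+n_{i+1}-1, n_i - 1), where n_{ℓ-1} = n_{r+1} = 0. -/

import Mathlib

/-- Rooted binary trees, encoded so that a tree is a `node` whose two
(sub)trees may be `nil` (absent child).  The empty tree `nil` itself is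
not a binary tree: a binary tree is a `t ≠ nil`. -/
inductive BinTree : Type
  | nil : BinTree
  | node : BinTree → BinTree → BinTree
deriving DecidableEq

namespace BinTree

/-- `cnt t j` is the number of nodes of `t` at abscissa `j` in the canonical
embedding of `t` in `ℤ` with the root at abscissa `0`: the left (resp. right)
child of a node of abscissa `i` has abscissa `i - 1` (resp. `i + 1`). -/
def cnt : BinTree → ℤ → ℕ
  | nil, _ => 0
  | node l r, j => (if j = 0 then 1 else 0) + cnt l (j + 1) + cnt r (j - 1)

end BinTree

namespace BinTree

def wt : List ℤ → List BinTree → ℤ → ℕ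
  | p :: L, t :: f, i => cnt t (i - p) + wt L f i
  | _, _, _ => 0

def fors (L : List ℤ) (n : ℤ → ℕ) : Set (List BinTree) :=
  {f | f.length = L.length ∧ ∀ i, wt L f i = n i}

def glue : List BinTree → List BinTree
  | l :: r :: f => node l r :: f
  | f => f

def cc : ℕ → ℕ → ℚ
  | _, 0 => 0
  | 0, n + 1 => (-1) ^ n
  | N + 1, n + 1 => (N.choose n : ℚ)

theorem cc_zero (N : ℕ) : cc N 0 = 0 := by simp [cc]

theorem cc_pascal (N n : ℕ) : cc (N + 1) (n + 1) = cc N (n + 1) + cc N n := by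
  cases N with
  | zero => cases n with
    | zero => simp [cc]
    | succ n => simp [cc, pow_succ]
  | succ N => cases n with
    | zero => simp [cc]
    | succ n => simp [cc, Nat.choose_succ_succ]; ring

theorem cc_absorb (N n : ℕ) : (N : ℚ) * cc N n = (N.choose n : ℚ) * n := by
  cases N with
  | zero => cases n <;> simp [cc]
  | succ N => cases n with
    | zero => simp [cc]
    | succ n =>
      have := Nat.add_one_mul_choose_eq N n
      simp only [cc]
      exact_mod_cast this

def tri (ℓ r : ℤ) (C c : ℤ → ℚ) : Matrix (Finset.Icc ℓ r) (Finset.Icc ℓ r) ℚ :=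
  Matrix.of fun i j => (if j.1 = i.1 then C i.1 else 0)
    - c i.1 * ((if j.1 = i.1 - 1 then 1 else 0) + (if j.1 = i.1 + 1 then 1 else 0))

theorem tri_congr (ℓ r : ℤ) (C c C' c' : ℤ → ℚ)
    (h : ∀ i ∈ Finset.Icc ℓ r, C i = C' i ∧ c i = c' i) : tri ℓ r C c = tri ℓ r C' c' := by
  ext i j
  simp [tri, (h i.1 i.2).1, (h i.1 i.2).2]

theorem tri_step (ℓ r : ℤ) (C c C1 c1 C2 c2 : ℤ → ℚ) (p : ℤ) (hp : p ∈ Finset.Icc ℓ r)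
    (h1 : ∀ i ∈ Finset.Icc ℓ r, i ≠ p → C i = C1 i ∧ c i = c1 i)
    (h2 : ∀ i ∈ Finset.Icc ℓ r, i ≠ p → C i = C2 i ∧ c i = c2 i)
    (hC : C p = C1 p + C2 p) (hc : c p = c1 p + c2 p) :
    (tri ℓ r C c).det = (tri ℓ r C1 c1).det + (tri ℓ r C2 c2).det := by
  have e0 : tri ℓ r C c = (tri ℓ r C c).updateRow ⟨p, hp⟩
      (tri ℓ r C1 c1 ⟨p, hp⟩ + tri ℓ r C2 c2 ⟨p, hp⟩) := by
    ext i j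
    by_cases hi : i = ⟨p, hp⟩
    · subst hi
      simp only [Matrix.updateRow_self, Pi.add_apply, tri, Matrix.of_apply, hC, hc]
      split_ifs <;> ring
    · simp [Matrix.updateRow_ne hi]
  have e1 : tri ℓ r C1 c1 = (tri ℓ r C c).updateRow ⟨p, hp⟩ (tri ℓ r C1 c1 ⟨p, hp⟩) := by
    ext i j
    by_cases hi : i = ⟨p, hp⟩
    · subst hi; simp
    · have := h1 i.1 i.2 (fun h => hi (Subtype.ext h))
      simp [Matrix.updateRow_ne hi, tri, this.1, this.2]
  have e2 : tri ℓ r C2 c2 = (tri ℓ r C c).updateRow ⟨p, hp⟩ (tri ℓ r C2 c2 ⟨p, hp⟩) := by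
    ext i j
    by_cases hi : i = ⟨p, hp⟩
    · subst hi; simp
    · have := h2 i.1 i.2 (fun h => hi (Subtype.ext h))
      simp [Matrix.updateRow_ne hi, tri, this.1, this.2]
  rw [e0, Matrix.det_updateRow_add, ← e1, ← e2]

theorem sum_tri (ℓ r : ℤ) (C c v : ℤ → ℚ) (hc : ∀ i, i < ℓ ∨ r < i → c i = 0)
    (j : Finset.Icc ℓ r) :
    ∑ i : Finset.Icc ℓ r, v i.1 * tri ℓ r C c i j =
      v j.1 * C j.1 - v (j.1 + 1) * c (j.1 + 1) - v (j.1 - 1) * c (j.1 - 1) := by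
  obtain ⟨j, hj⟩ := j
  have key : ∀ k : ℤ, ∑ i ∈ Finset.Icc ℓ r, (if i = k then v i * c i else 0) = v k * c k := by
    intro k
    rw [Finset.sum_ite_eq']
    split_ifs with h
    · rfl
    · rw [hc k (by simp at h; by_cases h' : k < ℓ; exact Or.inl h'; right; apply h; omega)]
      simp
  have key2 : ∑ i ∈ Finset.Icc ℓ r, (if i = j then v i * C i else 0) = v j * C j := by
    rw [Finset.sum_ite_eq', if_pos hj]
  rw [← key (j+1), ← key (j-1), ← key2, ← Finset.sum_sub_distrib, ← Finset.sum_sub_distrib,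
    ← Finset.sum_coe_sort (Finset.Icc ℓ r)]
  refine Finset.sum_congr rfl fun i _ => ?_
  obtain ⟨i, hi⟩ := i
  simp only [tri, Matrix.of_apply]
  have a1 : (j = i) = (i = j) := propext eq_comm
  have a2 : (j = i - 1) = (i = j + 1) := by apply propext; omega
  have a3 : (j = i + 1) = (i = j - 1) := by apply propext; omega
  simp only [a1, a2, a3]
  split_ifs <;> ring

theorem tri_det_zero (ℓ r : ℤ) (C c v : ℤ → ℚ) (hc : ∀ i, i < ℓ ∨ r < i → c i = 0)
    (hv : ∃ i ∈ Finset.Icc ℓ r, v i ≠ 0)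
    (h : ∀ j ∈ Finset.Icc ℓ r, v j * C j - v (j + 1) * c (j + 1) - v (j - 1) * c (j - 1) = 0) :
    (tri ℓ r C c).det = 0 := by
  rw [← Matrix.exists_vecMul_eq_zero_iff]
  obtain ⟨i, hi, hvi⟩ := hv
  refine ⟨fun i => v i.1, fun h => hvi (congrFun h ⟨i, hi⟩), ?_⟩
  ext j
  have := sum_tri ℓ r C c v hc j
  rw [h j.1 j.2] at this
  simpa [Matrix.vecMul, dotProduct] using this

def NN (L : List ℤ) (n : ℤ → ℕ) (i : ℤ) : ℕ := L.count i + n (i - 1) + n (i + 1)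

def MM (ℓ r : ℤ) (L : List ℤ) (n : ℤ → ℕ) :=
  tri ℓ r (fun i => ((NN L n i).choose (n i) : ℚ)) (fun i => cc (NN L n i) (n i))

theorem base_zero (ℓ r : ℤ) (n : ℤ → ℕ) (hzero : ∀ i : ℤ, i < ℓ ∨ r < i → n i = 0)
    (hn : ∃ i, n i ≠ 0) : (MM ℓ r [] n).det = 0 := by
  have hc : ∀ i, i < ℓ ∨ r < i → cc (NN [] n i) (n i) = 0 := by
    intro i hi; rw [hzero i hi]; simp [cc]
  have hin : ∀ i, n i ≠ 0 → i ∈ Finset.Icc ℓ r := by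
    intro i hi
    by_contra h
    apply hi; apply hzero
    simp at h
    by_cases h' : i < ℓ
    · exact Or.inl h'
    · right; apply h; omega
  by_cases hA1 : ∃ i, n i ≠ 0 ∧ NN [] n i = 0
  · obtain ⟨i, hi, hN⟩ := hA1
    have hN' := hN
    simp [NN] at hN'
    apply tri_det_zero ℓ r _ _ (fun k => if k = i then 1 else
      if k = i - 1 then cc 0 (n i) else if k = i + 1 then cc 0 (n i) else 0) hc
    · exact ⟨i, hin i hi, by simp⟩
    · intro j hj
      by_cases h1 : j = i
      · subst h1
        simp [hN, hN'.1, hN'.2, cc, Nat.choose_eq_zero_of_lt (Nat.pos_of_ne_zero hi)]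
      · by_cases h2 : j = i - 1
        · subst h2
          have q1 : i - 1 - 1 ≠ i := by omega
          have q2 : i - 1 - 1 ≠ i - 1 := by omega
          have q3 : i - 1 - 1 ≠ i + 1 := by omega
          simp [hN, hN'.1, q1, q2, q3]
        · by_cases h3 : j = i + 1
          · subst h3
            have q1 : i + 1 + 1 ≠ i := by omega
            have q2 : i + 1 + 1 ≠ i - 1 := by omega
            have q3 : i + 1 + 1 ≠ i + 1 := by omega
            simp [hN, hN'.2, q1, q2, q3]
          · have q1 : j + 1 ≠ i := by omega
            have q2 : j - 1 ≠ i := by omega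
            simp only [if_neg h1, if_neg h2, if_neg h3, if_neg q1, if_neg q2]
            split_ifs with a b c d e f g <;> simp [*, cc_zero]
  push Not at hA1
  by_cases hA2 : ∃ i, n i ≠ 0 ∧ (NN [] n i).choose (n i) = 0
  · obtain ⟨i, hi, hch⟩ := hA2
    have hcc : cc (NN [] n i) (n i) = 0 := by
      have := cc_absorb (NN [] n i) (n i)
      rw [hch] at this
      have h2 : (NN [] n i : ℚ) ≠ 0 := by exact_mod_cast hA1 i hi
      simpa [h2] using this
    apply tri_det_zero ℓ r _ _ (fun k => if k = i then 1 else 0) hc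
    · exact ⟨i, hin i hi, by simp⟩
    · intro j hj
      split_ifs <;> simp_all
  push Not at hA2
  have hch : ∀ i, ((NN [] n i).choose (n i) : ℚ) ≠ 0 := by
    intro i
    by_cases h : n i = 0
    · simp [h]
    · exact_mod_cast hA2 i h
  have hvc : ∀ i, (NN [] n i : ℚ) / ((NN [] n i).choose (n i) : ℚ) * cc (NN [] n i) (n i) = n i := by
    intro i
    rw [div_mul_eq_mul_div, cc_absorb, mul_div_cancel_left₀ _ (hch i)]
  apply tri_det_zero ℓ r _ _ (fun k => (NN [] n k : ℚ) / ((NN [] n k).choose (n k) : ℚ)) hc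
  · obtain ⟨i, hi⟩ := hn
    refine ⟨i, hin i hi, div_ne_zero ?_ (hch i)⟩
    exact_mod_cast hA1 i hi
  · intro j hj
    rw [hvc, hvc, div_mul_cancel₀ _ (hch j)]
    simp [NN]

theorem fors_cons (p : ℤ) (L : List ℤ) (n : ℤ → ℕ) (hp : n p ≠ 0) :
    fors (p :: L) n = (fun f => nil :: f) '' fors L n ∪
      glue '' fors ((p - 1) :: (p + 1) :: L) (fun i => n i - if i = p then 1 else 0) := by
  ext f
  constructor
  · rintro ⟨h1, h2⟩
    match f, h1, h2 with
    | nil :: f, h1, h2 =>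
      left
      refine ⟨f, ⟨by simpa using h1, fun i => ?_⟩, rfl⟩
      have := h2 i
      simpa [wt, cnt] using this
    | node a b :: f, h1, h2 =>
      right
      refine ⟨a :: b :: f, ⟨by simpa using h1, fun i => ?_⟩, rfl⟩
      have := h2 i
      simp only [wt, cnt] at this ⊢
      rw [show i - (p - 1) = i - p + 1 by ring, show i - (p + 1) = i - p - 1 by ring]
      by_cases hi : i = p
      · subst hi; simp at this ⊢; omega
      · have : i - p ≠ 0 := by omega
        simp_all; omega
  · rintro (⟨f, ⟨h1, h2⟩, rfl⟩ | ⟨f, ⟨h1, h2⟩, rfl⟩)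
    · refine ⟨by simpa using h1, fun i => ?_⟩
      have := h2 i
      simpa [wt, cnt] using this
    · match f, h1, h2 with
      | a :: b :: f, h1, h2 =>
        refine ⟨by simpa [glue] using h1, fun i => ?_⟩
        have := h2 i
        simp only [wt, cnt, glue] at this ⊢
        rw [show i - (p - 1) = i - p + 1 by ring, show i - (p + 1) = i - p - 1 by ring] at this
        by_cases hi : i = p
        · subst hi; simp at this ⊢; omega
        · have : i - p ≠ 0 := by omega
          simp_all; omega

theorem fors_cons_zero (p : ℤ) (L : List ℤ) (n : ℤ → ℕ) (hp : n p = 0) :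
    fors (p :: L) n = (fun f => nil :: f) '' fors L n := by
  ext f
  constructor
  · rintro ⟨h1, h2⟩
    match f, h1, h2 with
    | nil :: f, h1, h2 =>
      refine ⟨f, ⟨by simpa using h1, fun i => ?_⟩, rfl⟩
      have := h2 i
      simpa [wt, cnt] using this
    | node a b :: f, h1, h2 =>
      exfalso
      have := h2 p
      simp [wt, cnt, hp] at this
  · rintro ⟨f, ⟨h1, h2⟩, rfl⟩
    refine ⟨by simpa using h1, fun i => ?_⟩
    have := h2 i
    simpa [wt, cnt] using this

theorem glue_inj (p q : ℤ) (L : List ℤ) (n : ℤ → ℕ) : Set.InjOn glue (fors (p :: q :: L) n) := by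
  rintro f ⟨hf, -⟩ g ⟨hg, -⟩ h
  match f, g, hf, hg with
  | a :: b :: f, a' :: b' :: g, _, _ =>
    simp only [glue, List.cons.injEq, node.injEq] at h
    simp [h]

theorem disj (p q : ℤ) (L L' : List ℤ) (n n' : ℤ → ℕ) :
    Disjoint ((fun f => nil :: f) '' fors L n) (glue '' fors (p :: q :: L') n') := by
  rw [Set.disjoint_left]
  rintro _ ⟨f, -, rfl⟩ ⟨g, ⟨hg, -⟩, h⟩
  match g, hg with
  | a :: b :: g, _ => simp [glue] at h

theorem fors_nil_zero (n : ℤ → ℕ) (hn : ∀ i, n i = 0) : fors [] n = {[]} := by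
  ext f
  constructor
  · rintro ⟨h, -⟩; simpa using h
  · rintro rfl; exact ⟨rfl, fun i => by simp [wt, hn]⟩

theorem fors_nil_ne (n : ℤ → ℕ) (hn : ∃ i, n i ≠ 0) : fors [] n = ∅ := by
  ext f
  simp only [Set.mem_empty_iff_false, iff_false]
  rintro ⟨-, h⟩
  obtain ⟨i, hi⟩ := hn
  apply hi
  rw [← h i]
  cases f <;> simp [wt]

theorem main_count (ℓ r : ℤ) (m : ℕ) : ∀ (L : List ℤ) (n : ℤ → ℕ),
    (∀ i : ℤ, i < ℓ ∨ r < i → n i = 0) → ∑ i ∈ Finset.Icc ℓ r, n i = m →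
    (fors L n).Finite ∧ ((fors L n).ncard : ℚ) = (MM ℓ r L n).det := by
  induction m using Nat.strong_induction_on with
  | _ m IH =>
  intro L
  induction L with
  | nil =>
    intro n hzero hm
    by_cases hn : ∃ i, n i ≠ 0
    · rw [fors_nil_ne n hn, base_zero ℓ r n hzero hn]
      simp
    · push Not at hn
      rw [fors_nil_zero n hn]
      have : MM ℓ r [] n = 1 := by
        ext i j
        simp only [MM, tri, Matrix.of_apply, hn, cc_zero, Matrix.one_apply, Subtype.ext_iff]
        simp [eq_comm]
      rw [this]
      simp
  | cons p L ihL =>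
    intro n hzero hm
    obtain ⟨f1, d1⟩ := ihL n hzero hm
    have inj : Function.Injective (fun f : List BinTree => nil :: f) := by
      intro a b h; simpa using h
    by_cases hp : n p = 0
    · rw [fors_cons_zero p L n hp]
      refine ⟨f1.image _, ?_⟩
      rw [Set.ncard_image_of_injective _ inj, d1]
      unfold MM
      congr 1
      apply tri_congr
      intro i hi
      by_cases h : i = p
      · subst h; simp [hp, cc_zero]
      · have : NN (p :: L) n i = NN L n i := by
          simp [NN, List.count_cons, Ne.symm h]
        rw [this]; simp
    · set n' : ℤ → ℕ := fun i => n i - if i = p then 1 else 0 with hn'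
      have hpin : p ∈ Finset.Icc ℓ r := by
        by_contra h
        apply hp; apply hzero
        simp at h
        by_cases h' : p < ℓ
        · exact Or.inl h'
        · right; apply h; omega
      have hn'p : n' p + 1 = n p := by simp [hn']; omega
      have hn'ne : ∀ i, i ≠ p → n' i = n i := by intro i hi; simp [hn', hi]
      have hz' : ∀ i : ℤ, i < ℓ ∨ r < i → n' i = 0 := by
        intro i hi; simp [hn', hzero i hi]
      have hs : ∑ i ∈ Finset.Icc ℓ r, n' i < m := by
        rw [← hm]
        apply Finset.sum_lt_sum
        · intro i _; simp [hn']
        · exact ⟨p, hpin, by omega⟩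
      obtain ⟨f2, d2⟩ := IH _ hs ((p - 1) :: (p + 1) :: L) n' hz' rfl
      rw [fors_cons p L n hp]
      refine ⟨(f1.image _).union (f2.image _), ?_⟩
      rw [Set.ncard_union_eq (disj _ _ _ _ _ _) (f1.image _) (f2.image _),
        Set.ncard_image_of_injective _ inj, (glue_inj _ _ _ _).ncard_image]
      push_cast
      rw [d1, d2]
      symm
      unfold MM
      have N1 : ∀ i, i ≠ p → NN (p :: L) n i = NN L n i := by
        intro i hi; simp [NN, List.count_cons, Ne.symm hi]
      have N1p : NN (p :: L) n p = NN L n p + 1 := by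
        simp [NN, List.count_cons]; omega
      have N2p : NN ((p - 1) :: (p + 1) :: L) n' p = NN L n p := by
        simp [NN, List.count_cons, hn']
      have N2 : ∀ i, i ≠ p → NN ((p - 1) :: (p + 1) :: L) n' i = NN L n i := by
        intro i hi
        simp only [NN, List.count_cons, beq_iff_eq]
        by_cases h1 : i = p - 1
        · subst h1
          rw [hn'ne (p - 1 - 1) (by omega)]
          have : p + 1 ≠ p - 1 := by omega
          simp [this]; omega
        · by_cases h2 : i = p + 1
          · subst h2
            rw [hn'ne (p + 1 + 1) (by omega)]
            have : p - 1 ≠ p + 1 := by omega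
            simp [this]; omega
          · rw [hn'ne (i - 1) (by omega), hn'ne (i + 1) (by omega), if_neg (Ne.symm h1),
              if_neg (Ne.symm h2), add_zero, add_zero]
      apply tri_step ℓ r _ _ _ _ _ _ p hpin
      · intro i _ hi
        simp only [N1 i hi, and_self]
      · intro i _ hi
        simp only [N1 i hi, N2 i hi, hn'ne i hi, and_self]
      · simp only [N1p, N2p, ← hn'p, Nat.choose_succ_succ]
        push_cast; ring
      · simp only [N1p, N2p, ← hn'p, cc_pascal]

def ord (i : ℤ) : ℕ := if 0 ≤ i then (2 * i).toNat else (-2 * i - 1).toNat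

theorem ord_inj {i j : ℤ} (h : ord i = ord j) : i = j := by
  unfold ord at h; split_ifs at h <;> omega

theorem det_up {ι : Type*} [Fintype ι] [DecidableEq ι] (b : ι → ℕ) (hb : Function.Injective b)
    (M : Matrix ι ι ℚ) (h : ∀ i j, b j < b i → M i j = 0) : M.det = ∏ i, M i i := by
  letI : LinearOrder ι := LinearOrder.lift' b hb
  convert Matrix.det_of_isUpperTriangular (M := M) ?_
  intro i j hij
  exact h i j hij

theorem det_lo {ι : Type*} [Fintype ι] [DecidableEq ι] (b : ι → ℕ) (hb : Function.Injective b)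
    (M : Matrix ι ι ℚ) (h : ∀ i j, b i < b j → M i j = 0) : M.det = ∏ i, M i i := by
  rw [← Matrix.det_transpose, det_up b hb]
  · rfl
  · intro i j hij; exact h j i hij

theorem det_lap (ℓ r : ℤ) (n N : ℤ → ℚ)
    (hzero : ∀ i : ℤ, i < ℓ ∨ r < i → n i = 0)
    (hN : ∀ i, N i = (if i = 0 then 1 else 0) + n (i - 1) + n (i + 1)) :
    (tri ℓ r N n).det = ∏ i ∈ Finset.Icc ℓ r,
      (if 0 < i then n (i - 1) else if i < 0 then n (i + 1) else 1) := by
  let g : ℤ → ℤ → ℚ := fun i k =>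
    if 0 < i then (if i ≤ k then 1 else 0) else if i < 0 then (if k ≤ i then 1 else 0) else 1
  let P : Matrix (Finset.Icc ℓ r) (Finset.Icc ℓ r) ℚ := Matrix.of fun i k => g i.1 k.1
  have hinj : Function.Injective (fun i : Finset.Icc ℓ r => ord i.1) :=
    fun i j h => Subtype.ext (ord_inj h)
  have hP : P.det = 1 := by
    rw [det_up (fun i => ord i.1) hinj]
    · apply Finset.prod_eq_one
      intro i _
      simp [P, g]
    · intro i j h
      simp only [ord] at h
      simp only [P, g, Matrix.of_apply]
      split_ifs at h ⊢ <;> first | rfl | (exfalso; omega)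
  have hPL : ∀ i j : Finset.Icc ℓ r, (P * tri ℓ r N n) i j = g i.1 j.1 * N j.1
      - g i.1 (j.1 + 1) * n (j.1 + 1) - g i.1 (j.1 - 1) * n (j.1 - 1) := by
    intro i j
    rw [← sum_tri ℓ r N n (g i.1) hzero j, Matrix.mul_apply]
    rfl
  have : (P * tri ℓ r N n).det = (tri ℓ r N n).det := by
    rw [Matrix.det_mul, hP, one_mul]
  rw [← this, det_lo (fun i => ord i.1) hinj]
  · rw [← Finset.prod_coe_sort (Finset.Icc ℓ r)]
    refine Finset.prod_congr rfl fun i _ => ?_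
    rw [hPL, hN]
    obtain ⟨i, hi⟩ := i
    simp only [g]
    split_ifs <;> first | (exfalso; omega) | ring
  · intro i j h
    rw [hPL, hN]
    obtain ⟨i, hi⟩ := i
    obtain ⟨j, hj⟩ := j
    simp only [ord] at h
    simp only [g]
    split_ifs at h ⊢ <;> first | (exfalso; omega) | ring

theorem prod_shift_up (r : ℕ) (n : ℤ → ℚ) :
    (∏ i ∈ Finset.Ioc (0 : ℤ) r, n (i - 1)) * n r = n 0 * ∏ i ∈ Finset.Ioc (0 : ℤ) r, n i := by
  induction r with
  | zero => simp
  | succ r ih =>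
    have : Finset.Ioc (0 : ℤ) ((r + 1 : ℕ) : ℤ) = insert ((r + 1 : ℕ) : ℤ) (Finset.Ioc (0 : ℤ) r) := by
      ext x; simp; omega
    rw [this, Finset.prod_insert (by simp), Finset.prod_insert (by simp)]
    push_cast
    rw [show (r : ℤ) + 1 - 1 = r by ring]
    linear_combination n (r + 1) * ih

theorem prod_shift_dn (r : ℕ) (n : ℤ → ℚ) :
    (∏ i ∈ Finset.Ico (-r : ℤ) 0, n (i + 1)) * n (-r) = n 0 * ∏ i ∈ Finset.Ico (-r : ℤ) 0, n i := by
  induction r with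
  | zero => simp
  | succ r ih =>
    have : Finset.Ico (-((r + 1 : ℕ) : ℤ)) 0 = insert (-((r + 1 : ℕ) : ℤ)) (Finset.Ico (-r : ℤ) 0) := by
      ext x; simp; omega
    rw [this, Finset.prod_insert (by simp), Finset.prod_insert (by simp)]
    push_cast
    rw [show -((r : ℤ) + 1) + 1 = -r by ring]
    linear_combination n (-(r + 1)) * ih

theorem prod_split (ℓ r : ℤ) (hl : ℓ ≤ 0) (hr : 0 ≤ r) (f : ℤ → ℚ) :
    ∏ i ∈ Finset.Icc ℓ r, f i =
      (∏ i ∈ Finset.Ico ℓ 0, f i) * f 0 * ∏ i ∈ Finset.Ioc 0 r, f i := by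
  have : Finset.Icc ℓ r = Finset.Ico ℓ 0 ∪ insert 0 (Finset.Ioc 0 r) := by
    ext x; simp; omega
  rw [this, Finset.prod_union, Finset.prod_insert (by simp), mul_assoc]
  rw [Finset.disjoint_left]
  intro x; simp; omega

theorem det_lap' (ℓ r : ℤ) (hl : ℓ ≤ 0) (hr : 0 ≤ r) (n N : ℤ → ℚ)
    (hzero : ∀ i : ℤ, i < ℓ ∨ r < i → n i = 0)
    (hN : ∀ i, N i = (if i = 0 then 1 else 0) + n (i - 1) + n (i + 1)) :
    (tri ℓ r N n).det * (n ℓ * n r) = n 0 * ∏ i ∈ Finset.Icc ℓ r, n i := by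
  rw [det_lap ℓ r n N hzero hN, prod_split ℓ r hl hr, prod_split ℓ r hl hr]
  have e1 : ∏ i ∈ Finset.Ioc 0 r,
      (if 0 < i then n (i - 1) else if i < 0 then n (i + 1) else 1) =
      ∏ i ∈ Finset.Ioc 0 r, n (i - 1) := by
    refine Finset.prod_congr rfl fun i hi => ?_
    simp at hi; simp [hi.1]
  have e2 : ∏ i ∈ Finset.Ico ℓ 0,
      (if 0 < i then n (i - 1) else if i < 0 then n (i + 1) else 1) =
      ∏ i ∈ Finset.Ico ℓ 0, n (i + 1) := by
    refine Finset.prod_congr rfl fun i hi => ?_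
    simp at hi
    rw [if_neg (by omega), if_pos hi.2]
  rw [e1, e2]
  obtain ⟨a, rfl⟩ := Int.eq_ofNat_of_zero_le hr
  obtain ⟨b, hb⟩ := Int.eq_ofNat_of_zero_le (neg_nonneg.2 hl)
  obtain rfl : ℓ = -(b : ℤ) := by omega
  have h1 := prod_shift_up a n
  have h2 := prod_shift_dn b n
  simp only [lt_irrefl, if_false, mul_one]
  calc _ = ((∏ i ∈ Finset.Ico (-b : ℤ) 0, n (i + 1)) * n (-b)) *
        ((∏ i ∈ Finset.Ioc (0 : ℤ) a, n (i - 1)) * n a) := by ring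
    _ = _ := by rw [h1, h2]; ring

theorem tri_scale (ℓ r : ℤ) (d e C c C' c' : ℤ → ℚ)
    (h : ∀ i ∈ Finset.Icc ℓ r, d i * C i = e i * C' i ∧ d i * c i = e i * c' i) :
    (∏ i ∈ Finset.Icc ℓ r, d i) * (tri ℓ r C c).det =
      (∏ i ∈ Finset.Icc ℓ r, e i) * (tri ℓ r C' c').det := by
  rw [← Finset.prod_coe_sort, ← Finset.prod_coe_sort (Finset.Icc ℓ r) e,
    ← Matrix.det_diagonal, ← Matrix.det_diagonal, ← Matrix.det_mul, ← Matrix.det_mul]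
  congr 1
  ext i j
  obtain ⟨h1, h2⟩ := h i.1 i.2
  simp only [Matrix.diagonal_mul, tri, Matrix.of_apply]
  rw [mul_sub, mul_sub, ← mul_assoc, ← mul_assoc, h2]
  congr 1
  split_ifs <;> simp [h1]

theorem fors_single (n : ℤ → ℕ) (h0 : n 0 ≠ 0) :
    {t : BinTree | t ≠ BinTree.nil ∧ ∀ i : ℤ, BinTree.cnt t i = n i}.ncard = (fors [0] n).ncard := by
  have inj : Function.Injective (fun t : BinTree => [t]) := by intro a b h; simpa using h
  rw [← Set.ncard_image_of_injective _ inj]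
  congr 1
  ext f
  constructor
  · rintro ⟨t, ⟨-, h⟩, rfl⟩
    exact ⟨rfl, fun i => by simp [wt, h]⟩
  · rintro ⟨h1, h2⟩
    match f, h1, h2 with
    | [t], _, h2 =>
      refine ⟨t, ⟨?_, fun i => ?_⟩, rfl⟩
      · rintro rfl
        apply h0
        rw [← h2 0]; simp [wt, cnt]
      · have := h2 i
        simpa [wt] using this

theorem cc_eq (N n : ℕ) (hN : 0 < N) (hn : 0 < n) : cc N n = ((N - 1).choose (n - 1) : ℚ) := by
  obtain ⟨N, rfl⟩ := Nat.exists_eq_succ_of_ne_zero hN.ne'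
  obtain ⟨n, rfl⟩ := Nat.exists_eq_succ_of_ne_zero hn.ne'
  simp [cc]

end BinTree

/-- The number of rooted binary trees with vertical profile
`(n ℓ, …, n r)` (all positive, `ℓ ≤ 0 ≤ r`, `n` vanishing outside `[ℓ, r]`)
is `(n 0 / (n ℓ * n r)) * C(n (-1) + n 1, n 0 - 1) *
∏_{ℓ ≤ i ≤ r, i ≠ 0} C(n (i-1) + n (i+1) - 1, n i - 1)`,
stated here with denominators cleared. -/
theorem binary_vertical_profile
    (ℓ r : ℤ) (hl : ℓ ≤ 0) (hr : 0 ≤ r) (n : ℤ → ℕ)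
    (hpos : ∀ i ∈ Finset.Icc ℓ r, 0 < n i)
    (hzero : ∀ i : ℤ, i < ℓ ∨ r < i → n i = 0) :
    {t : BinTree | t ≠ BinTree.nil ∧ ∀ i : ℤ, BinTree.cnt t i = n i}.ncard
        * (n ℓ * n r) =
      n 0 * Nat.choose (n (-1) + n 1) (n 0 - 1) *
        ∏ i ∈ (Finset.Icc ℓ r).erase 0,
          Nat.choose (n (i - 1) + n (i + 1) - 1) (n i - 1) := by
  open BinTree in
  have h0m : (0 : ℤ) ∈ Finset.Icc ℓ r := by simp [hl, hr]
  have h0 := hpos 0 h0m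
  rw [fors_single n h0.ne']
  have hNpos : ∀ i ∈ Finset.Icc ℓ r, 0 < NN [0] n i := by
    intro i hi
    simp only [NN, List.count_cons, List.count_nil, beq_iff_eq]
    simp only [Finset.mem_Icc] at hi
    rcases lt_trichotomy i 0 with h | h | h
    · have := hpos (i + 1) (by simp; omega)
      omega
    · subst h; simp
    · have := hpos (i - 1) (by simp; omega)
      omega
  have hd := (main_count ℓ r _ [0] n hzero rfl).2
  have hs := tri_scale ℓ r (fun i => (NN [0] n i : ℚ)) (fun i => ((NN [0] n i).choose (n i) : ℚ))
    (fun i => ((NN [0] n i).choose (n i) : ℚ)) (fun i => cc (NN [0] n i) (n i))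
    (fun i => (NN [0] n i : ℚ)) (fun i => (n i : ℚ))
    (fun i _ => ⟨mul_comm _ _, cc_absorb _ _⟩)
  have hlap := det_lap' ℓ r hl hr (fun i => (n i : ℚ)) (fun i => (NN [0] n i : ℚ))
    (fun i hi => by simp [hzero i hi])
    (fun i => by
      simp only [NN, List.count_cons, List.count_nil, beq_iff_eq, eq_comm (a := (0 : ℤ))]
      push_cast; ring)
  have hprod : (∏ i ∈ Finset.Icc ℓ r, ((NN [0] n i).choose (n i) : ℚ)) * ∏ i ∈ Finset.Icc ℓ r, (n i : ℚ)
      = (∏ i ∈ Finset.Icc ℓ r, (NN [0] n i : ℚ)) * ∏ i ∈ Finset.Icc ℓ r, cc (NN [0] n i) (n i) := by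
    rw [← Finset.prod_mul_distrib, ← Finset.prod_mul_distrib]
    exact Finset.prod_congr rfl fun i _ => (cc_absorb _ _).symm
  have hne : (∏ i ∈ Finset.Icc ℓ r, (NN [0] n i : ℚ)) ≠ 0 := by
    rw [Finset.prod_ne_zero_iff]
    intro i hi
    exact_mod_cast (hNpos i hi).ne'
  have hfin : ((fors [0] n).ncard : ℚ) * (n ℓ * n r) =
      n 0 * ∏ i ∈ Finset.Icc ℓ r, cc (NN [0] n i) (n i) := by
    apply mul_left_cancel₀ hne
    rw [hd]
    unfold MM
    calc _ = ((∏ i ∈ Finset.Icc ℓ r, (NN [0] n i : ℚ)) * (tri ℓ r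
          (fun i => ((NN [0] n i).choose (n i) : ℚ)) (fun i => cc (NN [0] n i) (n i))).det)
          * (n ℓ * n r) := by ring
      _ = _ := by
        rw [hs, mul_assoc, hlap]
        linear_combination (n 0 : ℚ) * hprod
  rw [← Finset.mul_prod_erase _ _ h0m] at hfin
  have c0 : cc (NN [0] n 0) (n 0) = ((n (-1) + n 1).choose (n 0 - 1) : ℚ) := by
    rw [cc_eq _ _ (hNpos 0 h0m) h0]
    congr 2
    simp [NN]; omega
  have ci : ∏ i ∈ (Finset.Icc ℓ r).erase 0, cc (NN [0] n i) (n i) =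
      ∏ i ∈ (Finset.Icc ℓ r).erase 0,
        ((n (i - 1) + n (i + 1) - 1).choose (n i - 1) : ℚ) := by
    refine Finset.prod_congr rfl fun i hi => ?_
    rw [Finset.mem_erase] at hi
    rw [cc_eq _ _ (hNpos i hi.2) (hpos i hi.2)]
    congr 3
    simp [NN, List.count_cons, Ne.symm hi.1]
  rw [c0, ci, ← mul_assoc (n 0 : ℚ)] at hfin
  exact_mod_cast hfin
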